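/- For all natural numbers m and n, the logic NRAmn enjoys the Craig interpolation property (CIP): whenever NRAmn ⊢ φ → ψ, there exists a modal formula χ such that V(χ) ⊆ V(φ) ∩ V(ψ), NRAmn ⊢ φ → χ, and NRAmn ⊢ χ → ψ. -/

import Mathlib

/-- Propositional formulas. -/
inductive PropForm : Type
  | var : ℕ → PropForm
  | fls : PropForm
  | and : PropForm → PropForm → PropForm
  | or : PropForm → PropForm → PropForm
  | imp : PropForm → PropForm → PropForm
  deriving DecidableEq

/-- Boolean evaluation of a propositional formula. -/
def PropForm.eval (v : ℕ → Bool) : PropForm → Bool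
  | .var i => v i
  | .fls => false
  | .and φ ψ => φ.eval v && ψ.eval v
  | .or φ ψ => φ.eval v || ψ.eval v
  | .imp φ ψ => !φ.eval v || ψ.eval v

/-- Classical propositional tautology. -/
def PropForm.Taut (φ : PropForm) : Prop := ∀ v, φ.eval v = true

/-- Modal formulas. -/
inductive ModalForm : Type
  | var : ℕ → ModalForm
  | fls : ModalForm
  | and : ModalForm → ModalForm → ModalForm
  | or : ModalForm → ModalForm → ModalForm
  | imp : ModalForm → ModalForm → ModalForm
  | box : ModalForm → ModalForm
  deriving DecidableEq

/-- Substitution of modal formulas for the variables of a propositional formula. -/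
def PropForm.subst (σ : ℕ → ModalForm) : PropForm → ModalForm
  | .var i => σ i
  | .fls => .fls
  | .and φ ψ => .and (φ.subst σ) (ψ.subst σ)
  | .or φ ψ => .or (φ.subst σ) (ψ.subst σ)
  | .imp φ ψ => .imp (φ.subst σ) (ψ.subst σ)

/-- ¬φ abbreviates φ → ⊥. -/
def ModalForm.neg (φ : ModalForm) : ModalForm := .imp φ .fls

/-- □^k φ : k-fold application of □. -/
def ModalForm.boxIter : ℕ → ModalForm → ModalForm
  | 0, φ => φ
  | k + 1, φ => .box (ModalForm.boxIter k φ)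

/-- ¬^j φ : j-fold application of ¬. -/
def ModalForm.negIter : ℕ → ModalForm → ModalForm
  | 0, φ => φ
  | k + 1, φ => (ModalForm.negIter k φ).neg

/-- φ ↔ ψ abbreviates (φ → ψ) ∧ (ψ → φ). -/
def ModalForm.iff (φ ψ : ModalForm) : ModalForm := .and (.imp φ ψ) (.imp ψ φ)

/-- Signed variables: `Vsgn φ true` is V⁺(φ), `Vsgn φ false` is V⁻(φ). -/
def ModalForm.Vsgn : ModalForm → Bool → Finset ℕ
  | .var i, true => {i}
  | .var _, false => ∅
  | .fls, _ => ∅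
  | .and φ ψ, b => φ.Vsgn b ∪ ψ.Vsgn b
  | .or φ ψ, b => φ.Vsgn b ∪ ψ.Vsgn b
  | .imp φ ψ, b => φ.Vsgn (!b) ∪ ψ.Vsgn b
  | .box φ, b => φ.Vsgn b

/-- Positive variables V⁺(φ). -/
def ModalForm.Vpos (φ : ModalForm) : Finset ℕ := φ.Vsgn true

/-- Negative variables V⁻(φ). -/
def ModalForm.Vneg (φ : ModalForm) : Finset ℕ := φ.Vsgn false

/-- All variables V(φ). -/
def ModalForm.V (φ : ModalForm) : Finset ℕ := φ.Vpos ∪ φ.Vneg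

/-- The logic NRAmn = NAmn + (Ros : from ¬φ infer ¬□φ). -/
inductive NRA (m n : ℕ) : ModalForm → Prop
  | taut (p : PropForm) (σ : ℕ → ModalForm) : p.Taut → NRA m n (p.subst σ)
  | amn (φ : ModalForm) : NRA m n (.imp (ModalForm.boxIter n φ) (ModalForm.boxIter m φ))
  | mp (φ ψ : ModalForm) : NRA m n (.imp φ ψ) → NRA m n φ → NRA m n ψ
  | nec (φ : ModalForm) : NRA m n φ → NRA m n (.box φ)
  | ros (φ : ModalForm) : NRA m n (ModalForm.neg φ) → NRA m n (ModalForm.neg (.box φ))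

namespace ModalForm

theorem V_and (φ ψ : ModalForm) : (ModalForm.and φ ψ).V = φ.V ∪ ψ.V := by
  ext i; simp only [V, Vpos, Vneg, Vsgn, Finset.mem_union]; tauto

theorem V_or (φ ψ : ModalForm) : (ModalForm.or φ ψ).V = φ.V ∪ ψ.V := by
  ext i; simp only [V, Vpos, Vneg, Vsgn, Finset.mem_union]; tauto

theorem V_imp (φ ψ : ModalForm) : (ModalForm.imp φ ψ).V = φ.V ∪ ψ.V := by
  ext i
  simp only [V, Vpos, Vneg, Vsgn, Finset.mem_union, Bool.not_true, Bool.not_false]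
  tauto

theorem V_var (i : ℕ) : (ModalForm.var i).V = {i} := by
  simp [V, Vpos, Vneg, Vsgn]

theorem V_fls : ModalForm.fls.V = ∅ := by
  simp [V, Vpos, Vneg, Vsgn]

theorem V_box (φ : ModalForm) : (ModalForm.box φ).V = φ.V := rfl

theorem V_neg (φ : ModalForm) : φ.neg.V = φ.V := by
  simp [neg, V_imp, V_fls]

theorem V_boxIter (k : ℕ) (φ : ModalForm) : (boxIter k φ).V = φ.V := by
  induction k with
  | zero => rfl
  | succ k ih => exact (V_box _).trans ih

end ModalForm

namespace NRA

variable {m n : ℕ}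

/-- Substitution instances of a tautology in at most three variables. -/
theorem taut₃ (p : PropForm) (hp : p.Taut) (a b c : ModalForm) :
    NRA m n (p.subst fun i => if i = 0 then a else if i = 1 then b else c) :=
  NRA.taut p _ hp

end NRA

/-- A set of formulas that contains every theorem and is closed under modus ponens. -/
structure IsNRATheory (m n : ℕ) (Γ : Set ModalForm) : Prop where
  of_provable : ∀ φ, NRA m n φ → φ ∈ Γ
  mp : ∀ φ ψ, ModalForm.imp φ ψ ∈ Γ → φ ∈ Γ → ψ ∈ Γ

namespace IsNRATheory

open ModalForm

variable {m n : ℕ} {Γ : Set ModalForm}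

theorem provable : IsNRATheory m n {φ | NRA m n φ} :=
  ⟨fun _ h => h, fun φ ψ => NRA.mp φ ψ⟩

theorem imp_self (hΓ : IsNRATheory m n Γ) (a : ModalForm) : imp a a ∈ Γ :=
  hΓ.of_provable _ <| NRA.taut₃ (.imp (.var 0) (.var 0))
    (fun v => by simp [PropForm.eval]) a a a

theorem imp_intro (hΓ : IsNRATheory m n Γ) {a b : ModalForm} (hb : b ∈ Γ) : imp a b ∈ Γ :=
  hΓ.mp _ _ (hΓ.of_provable _ <| NRA.taut₃ (.imp (.var 1) (.imp (.var 0) (.var 1)))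
    (fun v => by simp only [PropForm.eval]; cases v 0 <;> cases v 1 <;> rfl) a b b) hb

theorem imp_mp (hΓ : IsNRATheory m n Γ) {a b c : ModalForm} (hbc : imp a (imp b c) ∈ Γ)
    (hb : imp a b ∈ Γ) : imp a c ∈ Γ :=
  hΓ.mp _ _ (hΓ.mp _ _ (hΓ.of_provable _ <| NRA.taut₃
    (.imp (.imp (.var 0) (.imp (.var 1) (.var 2)))
      (.imp (.imp (.var 0) (.var 1)) (.imp (.var 0) (.var 2))))
    (fun v => by simp only [PropForm.eval]; cases v 0 <;> cases v 1 <;> cases v 2 <;> rfl)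
    a b c) hbc) hb

theorem imp_trans (hΓ : IsNRATheory m n Γ) {a b c : ModalForm} (hab : imp a b ∈ Γ)
    (hbc : imp b c ∈ Γ) : imp a c ∈ Γ :=
  hΓ.imp_mp (hΓ.imp_intro hbc) hab

theorem imp_swap (hΓ : IsNRATheory m n Γ) {a b c : ModalForm} (h : imp a (imp b c) ∈ Γ) :
    imp b (imp a c) ∈ Γ :=
  hΓ.mp _ _ (hΓ.of_provable _ <| NRA.taut₃
    (.imp (.imp (.var 0) (.imp (.var 1) (.var 2))) (.imp (.var 1) (.imp (.var 0) (.var 2))))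
    (fun v => by simp only [PropForm.eval]; cases v 0 <;> cases v 1 <;> cases v 2 <;> rfl)
    a b c) h

theorem imp_of_imp_neg_neg (hΓ : IsNRATheory m n Γ) {a b : ModalForm}
    (h : imp a b.neg.neg ∈ Γ) : imp a b ∈ Γ :=
  hΓ.imp_trans h <| hΓ.of_provable _ <| NRA.taut₃
    (.imp (.imp (.imp (.var 0) .fls) .fls) (.var 0))
    (fun v => by simp only [PropForm.eval]; cases v 0 <;> rfl) b b b

theorem and_imp_left (hΓ : IsNRATheory m n Γ) (a b : ModalForm) : imp (and a b) a ∈ Γ :=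
  hΓ.of_provable _ <| NRA.taut₃ (.imp (.and (.var 0) (.var 1)) (.var 0))
    (fun v => by simp only [PropForm.eval]; cases v 0 <;> cases v 1 <;> rfl) a b b

theorem and_imp_right (hΓ : IsNRATheory m n Γ) (a b : ModalForm) : imp (and a b) b ∈ Γ :=
  hΓ.of_provable _ <| NRA.taut₃ (.imp (.and (.var 0) (.var 1)) (.var 1))
    (fun v => by simp only [PropForm.eval]; cases v 0 <;> cases v 1 <;> rfl) a b b

theorem imp_and (hΓ : IsNRATheory m n Γ) {a b c : ModalForm} (hb : imp c a ∈ Γ)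
    (hc : imp c b ∈ Γ) : imp c (and a b) ∈ Γ :=
  hΓ.imp_mp (hΓ.imp_trans hb <| hΓ.of_provable _ <| NRA.taut₃
    (.imp (.var 0) (.imp (.var 1) (.and (.var 0) (.var 1))))
    (fun v => by simp only [PropForm.eval]; cases v 0 <;> cases v 1 <;> rfl) a b b) hc

theorem imp_or_left (hΓ : IsNRATheory m n Γ) (a b : ModalForm) : imp a (or a b) ∈ Γ :=
  hΓ.of_provable _ <| NRA.taut₃ (.imp (.var 0) (.or (.var 0) (.var 1)))
    (fun v => by simp only [PropForm.eval]; cases v 0 <;> cases v 1 <;> rfl) a b b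

theorem imp_or_right (hΓ : IsNRATheory m n Γ) (a b : ModalForm) : imp b (or a b) ∈ Γ :=
  hΓ.of_provable _ <| NRA.taut₃ (.imp (.var 1) (.or (.var 0) (.var 1)))
    (fun v => by simp only [PropForm.eval]; cases v 0 <;> cases v 1 <;> rfl) a b b

theorem of_or (hΓ : IsNRATheory m n Γ) {a b : ModalForm} (h : or a b ∈ Γ) (ha : a.neg ∈ Γ) :
    b ∈ Γ :=
  hΓ.mp _ _ (hΓ.mp _ _ (hΓ.of_provable _ <| NRA.taut₃
    (.imp (.or (.var 0) (.var 1)) (.imp (.imp (.var 0) .fls) (.var 1)))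
    (fun v => by simp only [PropForm.eval]; cases v 0 <;> cases v 1 <;> rfl) a b b) h) ha

theorem fls_imp (hΓ : IsNRATheory m n Γ) (a : ModalForm) : imp fls a ∈ Γ :=
  hΓ.of_provable _ <| NRA.taut₃ (.imp .fls (.var 0)) (fun v => by simp [PropForm.eval]) a a a

/-- The deduction theorem: `{ψ | φ → ψ ∈ Γ}` is a theory. -/
theorem adjoin (hΓ : IsNRATheory m n Γ) (φ : ModalForm) :
    IsNRATheory m n {ψ | imp φ ψ ∈ Γ} :=
  ⟨fun ψ h => hΓ.imp_intro (hΓ.of_provable ψ h), fun _ _ h h' => hΓ.imp_mp h h'⟩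

end IsNRATheory

/-- A consistent theory that decides every formula. -/
structure IsCompleteNRATheory (m n : ℕ) (Γ : Set ModalForm) : Prop
    extends IsNRATheory m n Γ where
  fls_notMem : ModalForm.fls ∉ Γ
  mem_or_neg_mem : ∀ φ : ModalForm, φ ∈ Γ ∨ φ.neg ∈ Γ

namespace IsCompleteNRATheory

open ModalForm

variable {m n : ℕ} {Γ : Set ModalForm}

theorem neg_mem_iff (hΓ : IsCompleteNRATheory m n Γ) (a : ModalForm) : a.neg ∈ Γ ↔ a ∉ Γ :=
  ⟨fun h ha => hΓ.fls_notMem (hΓ.mp _ _ h ha), (hΓ.mem_or_neg_mem a).resolve_left⟩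

theorem and_mem_iff (hΓ : IsCompleteNRATheory m n Γ) (a b : ModalForm) :
    and a b ∈ Γ ↔ a ∈ Γ ∧ b ∈ Γ :=
  ⟨fun h => ⟨hΓ.mp _ _ (hΓ.and_imp_left a b) h, hΓ.mp _ _ (hΓ.and_imp_right a b) h⟩,
    fun h => hΓ.mp _ _ (hΓ.imp_and (hΓ.imp_self a) (hΓ.imp_intro h.2)) h.1⟩

theorem or_mem_iff (hΓ : IsCompleteNRATheory m n Γ) (a b : ModalForm) :
    or a b ∈ Γ ↔ a ∈ Γ ∨ b ∈ Γ := by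
  constructor
  · intro h
    rcases hΓ.mem_or_neg_mem a with ha | ha
    · exact .inl ha
    · exact .inr (hΓ.of_or h ha)
  · rintro (h | h)
    · exact hΓ.mp _ _ (hΓ.imp_or_left a b) h
    · exact hΓ.mp _ _ (hΓ.imp_or_right a b) h

theorem imp_mem_iff (hΓ : IsCompleteNRATheory m n Γ) (a b : ModalForm) :
    imp a b ∈ Γ ↔ (a ∈ Γ → b ∈ Γ) := by
  refine ⟨hΓ.mp a b, fun h => ?_⟩
  rcases hΓ.mem_or_neg_mem a with ha | ha
  · exact hΓ.imp_intro (h ha)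
  · exact hΓ.imp_trans ha (hΓ.fls_imp b)

end IsCompleteNRATheory

/-- Lindenbaum's lemma. -/
theorem IsNRATheory.exists_complete {m n : ℕ} {Γ : Set ModalForm} (hΓ : IsNRATheory m n Γ)
    (hc : ModalForm.fls ∉ Γ) : ∃ Δ, Γ ⊆ Δ ∧ IsCompleteNRATheory m n Δ := by
  obtain ⟨Δ, hΓΔ, hmax⟩ := zorn_subset_nonempty
    {Δ | IsNRATheory m n Δ ∧ ModalForm.fls ∉ Δ} (fun c hcS hch ⟨Γ₀, hΓ₀⟩ => by
      refine ⟨⋃₀ c, ⟨⟨fun φ h => ⟨Γ₀, hΓ₀, (hcS hΓ₀).1.of_provable φ h⟩, ?_⟩, ?_⟩,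
        fun s => Set.subset_sUnion_of_mem⟩
      · rintro φ ψ ⟨s, hs, hφψ⟩ ⟨t, ht, hφ⟩
        rcases hch.total hs ht with hst | hts
        · exact ⟨t, ht, (hcS ht).1.mp _ _ (hst hφψ) hφ⟩
        · exact ⟨s, hs, (hcS hs).1.mp _ _ hφψ (hts hφ)⟩
      · rintro ⟨s, hs, hf⟩
        exact (hcS hs).2 hf) Γ ⟨hΓ, hc⟩
  obtain ⟨hΔ, hΔc⟩ := hmax.prop
  refine ⟨Δ, hΓΔ, hΔ, hΔc, fun φ => or_iff_not_imp_right.2 fun hφ => ?_⟩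
  exact hmax.le_of_ge ⟨hΔ.adjoin φ, hφ⟩ (fun _ => hΔ.imp_intro) (hΔ.imp_self φ)

/-- Lindenbaum's lemma for a set of assumptions closed under conjunction and one further
assumption. -/
theorem NRA.exists_complete {m n : ℕ} {D : Set ModalForm} (hne : D.Nonempty)
    (hand : ∀ a ∈ D, ∀ b ∈ D, ModalForm.and a b ∈ D) (β : ModalForm)
    (hcons : ∀ χ ∈ D, ¬ NRA m n (.imp χ β.neg)) :
    ∃ Δ, IsCompleteNRATheory m n Δ ∧ D ⊆ Δ ∧ β ∈ Δ := by
  have hP := IsNRATheory.provable (m := m) (n := n)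
  have hΓ : IsNRATheory m n {α | ∃ χ ∈ D, NRA m n (.imp χ (.imp β α))} := by
    constructor
    · intro α h
      obtain ⟨χ, hχ⟩ := hne
      exact ⟨χ, hχ, hP.imp_intro (hP.imp_intro h)⟩
    · rintro a b ⟨χ₁, h₁, hab⟩ ⟨χ₂, h₂, ha⟩
      refine ⟨_, hand _ h₁ _ h₂, ?_⟩
      exact (hP.adjoin (.and χ₁ χ₂)).imp_mp (hP.imp_trans (hP.and_imp_left χ₁ χ₂) hab)
        (hP.imp_trans (hP.and_imp_right χ₁ χ₂) ha)
  obtain ⟨Δ, hΓΔ, hΔ⟩ := hΓ.exists_complete fun ⟨χ, hχ, h⟩ => hcons χ hχ h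
  refine ⟨Δ, hΔ, fun χ hχ => hΓΔ ⟨χ, hχ, ?_⟩, hΓΔ ?_⟩
  · exact hP.imp_swap (hP.imp_intro (hP.imp_self χ))
  · obtain ⟨χ, hχ⟩ := hne
    exact ⟨χ, hχ, hP.imp_intro (hP.imp_self β)⟩

/-- The amalgam of two theories: formulas over `S` are read off from `A`, formulas over `T` from
`B`, and `□` is read as the identity in front of all other formulas. -/
def ModalForm.amalgam (A B : Set ModalForm) (S T : Finset ℕ) : ModalForm → Prop
  | .var i => (i ∈ S ∧ .var i ∈ A) ∨ (i ∉ S ∧ .var i ∈ B)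
  | .fls => False
  | .and φ ψ => φ.amalgam A B S T ∧ ψ.amalgam A B S T
  | .or φ ψ => φ.amalgam A B S T ∨ ψ.amalgam A B S T
  | .imp φ ψ => φ.amalgam A B S T → ψ.amalgam A B S T
  | .box φ => (φ.V ⊆ S ∧ .box φ ∈ A) ∨ (¬ φ.V ⊆ S ∧ φ.V ⊆ T ∧ .box φ ∈ B) ∨
      (¬ φ.V ⊆ S ∧ ¬ φ.V ⊆ T ∧ φ.amalgam A B S T)

namespace ModalForm

variable {m n : ℕ} {A B : Set ModalForm} {S T : Finset ℕ}

theorem amalgam_iff_left (hA : IsCompleteNRATheory m n A) (φ : ModalForm) (h : φ.V ⊆ S) :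
    φ.amalgam A B S T ↔ φ ∈ A := by
  induction φ with
  | var i =>
    have hi : i ∈ S := by simpa [V_var] using h
    simp [amalgam, hi]
  | fls => simp [amalgam, hA.fls_notMem]
  | and a b iha ihb =>
    rw [V_and, Finset.union_subset_iff] at h
    rw [amalgam, iha h.1, ihb h.2, hA.and_mem_iff]
  | or a b iha ihb =>
    rw [V_or, Finset.union_subset_iff] at h
    rw [amalgam, iha h.1, ihb h.2, hA.or_mem_iff]
  | imp a b iha ihb =>
    rw [V_imp, Finset.union_subset_iff] at h
    rw [amalgam, iha h.1, ihb h.2, hA.imp_mem_iff]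
  | box a _ =>
    rw [V_box] at h
    simp [amalgam, h]

theorem amalgam_iff_right (hB : IsCompleteNRATheory m n B)
    (hAB : ∀ χ : ModalForm, χ.V ⊆ S ∩ T → (χ ∈ A ↔ χ ∈ B)) (φ : ModalForm) (h : φ.V ⊆ T) :
    φ.amalgam A B S T ↔ φ ∈ B := by
  induction φ with
  | var i =>
    have hi : i ∈ T := by simpa [V_var] using h
    by_cases hS : i ∈ S
    · simpa [amalgam, hS] using hAB (.var i) (by simp [V_var, hS, hi])
    · simp [amalgam, hS]
  | fls => simp [amalgam, hB.fls_notMem]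
  | and a b iha ihb =>
    rw [V_and, Finset.union_subset_iff] at h
    rw [amalgam, iha h.1, ihb h.2, hB.and_mem_iff]
  | or a b iha ihb =>
    rw [V_or, Finset.union_subset_iff] at h
    rw [amalgam, iha h.1, ihb h.2, hB.or_mem_iff]
  | imp a b iha ihb =>
    rw [V_imp, Finset.union_subset_iff] at h
    rw [amalgam, iha h.1, ihb h.2, hB.imp_mem_iff]
  | box a _ =>
    rw [V_box] at h
    by_cases hS : a.V ⊆ S
    · simpa [amalgam, hS] using hAB (.box a) (Finset.subset_inter hS h)
    · simp [amalgam, hS, h]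

theorem amalgam_boxIter (φ : ModalForm) (hS : ¬ φ.V ⊆ S) (hT : ¬ φ.V ⊆ T) (k : ℕ) :
    (boxIter k φ).amalgam A B S T ↔ φ.amalgam A B S T := by
  induction k with
  | zero => rfl
  | succ k ih => simp [boxIter, amalgam, V_boxIter, hS, hT, ih]

open Classical in
theorem amalgam_subst (p : PropForm) (σ : ℕ → ModalForm) :
    (p.subst σ).amalgam A B S T ↔
      p.eval (fun i => decide ((σ i).amalgam A B S T)) = true := by
  induction p with
  | var i => simp [PropForm.subst, PropForm.eval]
  | fls => simp [PropForm.subst, PropForm.eval, amalgam]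
  | and a b iha ihb => simp [PropForm.subst, PropForm.eval, amalgam, iha, ihb]
  | or a b iha ihb => simp [PropForm.subst, PropForm.eval, amalgam, iha, ihb]
  | imp a b iha ihb =>
    simp [PropForm.subst, PropForm.eval, amalgam, iha, ihb, imp_iff_not_or]

theorem amalgam_of_provable (hA : IsCompleteNRATheory m n A) (hB : IsCompleteNRATheory m n B)
    (hAB : ∀ χ : ModalForm, χ.V ⊆ S ∩ T → (χ ∈ A ↔ χ ∈ B)) {φ : ModalForm} (h : NRA m n φ) :
    φ.amalgam A B S T := by
  have of_subset {θ : ModalForm} (hθ : NRA m n θ) (hV : θ.V ⊆ S ∨ θ.V ⊆ T) :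
      θ.amalgam A B S T := by
    rcases hV with hV | hV
    · exact (amalgam_iff_left hA θ hV).2 (hA.of_provable θ hθ)
    · exact (amalgam_iff_right hB hAB θ hV).2 (hB.of_provable θ hθ)
  induction h with
  | taut p σ hp => exact (amalgam_subst p σ).2 (hp _)
  | mp a b _ _ hab ha => exact hab ha
  | amn a =>
    by_cases hV : a.V ⊆ S ∨ a.V ⊆ T
    · exact of_subset (NRA.amn a) (by simpa [V_imp, V_boxIter] using hV)
    · rw [not_or] at hV
      rw [amalgam, amalgam_boxIter a hV.1 hV.2, amalgam_boxIter a hV.1 hV.2]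
      exact id
  | nec a ha ih =>
    by_cases hV : a.V ⊆ S ∨ a.V ⊆ T
    · exact of_subset (NRA.nec a ha) hV
    · rw [not_or] at hV
      exact (amalgam_boxIter a hV.1 hV.2 1).2 ih
  | ros a ha ih =>
    by_cases hV : a.V ⊆ S ∨ a.V ⊆ T
    · exact of_subset (NRA.ros a ha) (by rwa [V_neg, V_box])
    · rw [not_or] at hV
      exact fun hbox => ih ((amalgam_boxIter a hV.1 hV.2 1).1 hbox)

end ModalForm

open ModalForm in
/-- NRA enjoys the Craig interpolation property. -/
theorem NRA_CIP (m n : ℕ) (φ ψ : ModalForm) (h : NRA m n (.imp φ ψ)) :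
    ∃ χ : ModalForm,
      χ.V ⊆ φ.V ∩ ψ.V ∧ NRA m n (.imp φ χ) ∧ NRA m n (.imp χ ψ) := by
  by_contra! hno
  have hP := IsNRATheory.provable (m := m) (n := n)
  have hV_and {a b : ModalForm} (ha : a.V ⊆ φ.V ∩ ψ.V) (hb : b.V ⊆ φ.V ∩ ψ.V) :
      (ModalForm.and a b).V ⊆ φ.V ∩ ψ.V := by
    rw [V_and]; exact Finset.union_subset ha hb
  have hV_top : (imp fls fls).V ⊆ φ.V ∩ ψ.V := by simp [V_imp, V_fls]
  obtain ⟨B, hB, hDB, hψ⟩ := NRA.exists_complete (m := m) (n := n)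
    (D := {χ | χ.V ⊆ φ.V ∩ ψ.V ∧ NRA m n (.imp φ χ)})
    ⟨_, hV_top, hP.imp_intro (hP.imp_self fls)⟩
    (fun a ha b hb => ⟨hV_and ha.1 hb.1, hP.imp_and ha.2 hb.2⟩) ψ.neg
    (fun χ hχ hχψ => hno χ hχ.1 hχ.2 (hP.imp_of_imp_neg_neg hχψ))
  obtain ⟨A, hA, hDA, hφ⟩ := NRA.exists_complete (m := m) (n := n)
    (D := {χ | χ.V ⊆ φ.V ∩ ψ.V ∧ χ ∈ B})
    ⟨_, hV_top, hB.imp_self fls⟩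
    (fun a ha b hb => ⟨hV_and ha.1 hb.1, (hB.and_mem_iff a b).2 ⟨ha.2, hb.2⟩⟩) φ
    (fun χ hχ hχφ => (hB.neg_mem_iff χ).1
      (hDB ⟨(V_neg χ).symm ▸ hχ.1, hP.imp_swap hχφ⟩) hχ.2)
  have hAB (χ : ModalForm) (hχ : χ.V ⊆ φ.V ∩ ψ.V) : χ ∈ A ↔ χ ∈ B := by
    refine ⟨fun hχA => ?_, fun hχB => hDA ⟨hχ, hχB⟩⟩
    by_contra hχB
    exact (hA.neg_mem_iff χ).1 (hDA ⟨(V_neg χ).symm ▸ hχ, (hB.neg_mem_iff χ).2 hχB⟩) hχA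
  have hφψ := amalgam_of_provable hA hB hAB h
  exact (hB.neg_mem_iff ψ).1 hψ <| (amalgam_iff_right hB hAB ψ subset_rfl).1 <|
    hφψ <| (amalgam_iff_left hA φ subset_rfl).2 hφ
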